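/- arXiv:2201.08800 — 4 statements merged into one kernel-verified Lean document; each statement's English description precedes it below -/
import Mathlib

section
/- Let d ≥ 2 and k ≥ 2 be integers, and let F : ℝ^d → ℝ^d be the simple polynomial skew product F(x₁,…,x_d) = (x₁ + a, x₂ + h₂(x₁), x₃ + b₃₂x₂ + h₃(x₁), …, x_d + b_{d(d−1)}x_{d−1} + ⋯ + b_{d2}x₂ + h_d(x₁)), where a and the b_{ij} are real constants and each h_i is a real polynomial of degree ≤ k. Then for every x ∈ ℝ^d there exist real-coefficient polynomials P₁,…,P_d, with deg P₁ ≤ 1 and deg P_i ≤ i + k − 1 for 2 ≤ i ≤ d, such that for every n ≥ 0 the i-th coordinate of Fⁿ(x) equals P_i(n). -/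
open Finset

noncomputable section

open Polynomial in
/-- Partial sums of the values of a polynomial at the naturals are given by a polynomial whose
degree is larger by at most one. -/
theorem exists_polynomial_eval_eq_sum_range {K : Type*} [Field K] [CharZero K] (Q : K[X]) :
    ∃ P : K[X], P.natDegree ≤ Q.natDegree + 1 ∧
      ∀ n : ℕ, P.eval (n : K) = ∑ t ∈ range n, Q.eval (t : K) := by
  have faulhaber (p : ℕ) : ∃ S : K[X], S.natDegree ≤ p + 1 ∧
      ∀ n : ℕ, S.eval (n : K) = ∑ t ∈ range n, (t : K) ^ p := by
    refine ⟨∑ i ∈ range (p + 1),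
      C ((_root_.bernoulli i * (p + 1).choose i / (p + 1) : ℚ) : K) * X ^ (p + 1 - i), ?_, fun n => ?_⟩
    · exact natDegree_sum_le_of_forall_le _ _ fun i _ =>
        (natDegree_C_mul_X_pow_le _ _).trans (Nat.sub_le _ _)
    · have h := congrArg (Rat.cast : ℚ → K) (sum_range_pow n p)
      push_cast at h
      rw [h, eval_finsetSum]
      refine sum_congr rfl fun i _ => ?_
      simp only [eval_mul, eval_C, eval_pow, eval_X]
      push_cast
      ring
  choose S hSdeg hS using faulhaber
  refine ⟨∑ p ∈ range (Q.natDegree + 1), C (Q.coeff p) * S p, ?_, fun n => ?_⟩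
  · refine natDegree_sum_le_of_forall_le _ _ fun p hp => (natDegree_C_mul_le _ _).trans ?_
    have := hSdeg p
    have := mem_range.mp hp
    omega
  · simp only [eval_finsetSum, eval_mul, eval_C, hS, eval_eq_sum_range (p := Q), mul_sum]
    exact sum_comm

/-- The orbit coordinates of a simple polynomial skew product
`F : ℝ^d → ℝ^d` of degree `k` are polynomial in the time `n`, with `deg P₁ ≤ 1` and
`deg Pᵢ ≤ i + k - 1` for the `i`-th coordinate (`2 ≤ i ≤ d`; in the `0`-based indexing
used here the bound for coordinate `i` with `(i : ℕ) ≥ 1` reads `(i : ℕ) + k`). -/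
theorem orbit_coords_polynomial_simple_skew_product
    (d k : ℕ) (hd : 2 ≤ d) (hk : 2 ≤ k)
    (a : ℝ) (b : Fin d → Fin d → ℝ) (hp : Fin d → Polynomial ℝ)
    (hdeg : ∀ i : Fin d, (hp i).natDegree ≤ k)
    (F : (Fin d → ℝ) → (Fin d → ℝ))
    (hF : ∀ (x : Fin d → ℝ) (i : Fin d), F x i =
      if (i : ℕ) = 0 then x i + a
      else x i + (∑ j : Fin d, if 1 ≤ (j : ℕ) ∧ (j : ℕ) < (i : ℕ) then b i j * x j else 0)
        + (hp i).eval (x ⟨0, by omega⟩)) :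
    ∀ x : Fin d → ℝ, ∃ P : Fin d → Polynomial ℝ,
      (∀ i : Fin d, (i : ℕ) = 0 → (P i).natDegree ≤ 1) ∧
      (∀ i : Fin d, 1 ≤ (i : ℕ) → (P i).natDegree ≤ (i : ℕ) + k) ∧
      ∀ (n : ℕ) (i : Fin d), F^[n] x i = (P i).eval (n : ℝ) := by
  intro x
  have coord_zero (n : ℕ) : F^[n] x ⟨0, by omega⟩ = x ⟨0, by omega⟩ + n * a := by
    induction n with
    | zero => simp
    | succ n ih =>
      rw [Function.iterate_succ_apply', hF, if_pos rfl, ih]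
      push_cast
      ring
  have coord (i : Fin d) : ∃ P : Polynomial ℝ, ((i : ℕ) = 0 → P.natDegree ≤ 1) ∧
      (1 ≤ (i : ℕ) → P.natDegree ≤ (i : ℕ) + k) ∧
      ∀ n : ℕ, F^[n] x i = P.eval (n : ℝ) := by
    induction i using WellFoundedLT.induction with
    | ind i ih =>
    have linear_natDegree :
        (Polynomial.C a * Polynomial.X + Polynomial.C (x ⟨0, by omega⟩)).natDegree ≤ 1 :=
      Polynomial.natDegree_linear_le
    rcases Nat.eq_zero_or_pos (i : ℕ) with hi | hi
    · have i_eq : i = ⟨0, by omega⟩ := Fin.ext hi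
      refine ⟨_, fun _ => linear_natDegree, fun h => absurd hi (by omega), fun n => ?_⟩
      rw [i_eq, coord_zero]
      simp only [Polynomial.eval_add, Polynomial.eval_mul, Polynomial.eval_C, Polynomial.eval_X]
      ring
    · choose! P _ hPdeg hP using ih
      set Q : Polynomial ℝ :=
        (∑ j : Fin d, if 1 ≤ (j : ℕ) ∧ (j : ℕ) < (i : ℕ) then Polynomial.C (b i j) * P j else 0)
          + (hp i).comp (Polynomial.C a * Polynomial.X + Polynomial.C (x ⟨0, by omega⟩)) with hQ
      have hQdeg : Q.natDegree + 1 ≤ i + k := by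
        suffices Q.natDegree ≤ i + k - 1 by omega
        refine Polynomial.natDegree_add_le_of_degree_le
          (Polynomial.natDegree_sum_le_of_forall_le _ _ fun j _ => ?_) ?_
        · split_ifs with hj
          · have := hPdeg j hj.2 hj.1
            exact (Polynomial.natDegree_C_mul_le _ _).trans (by omega)
          · simp
        · refine Polynomial.natDegree_comp_le.trans
            ((Nat.mul_le_mul (hdeg i) linear_natDegree).trans ?_)
          omega
      have step (n : ℕ) : F^[n + 1] x i = F^[n] x i + Q.eval (n : ℝ) := by
        rw [Function.iterate_succ_apply', hF, if_neg hi.ne', coord_zero, add_assoc, hQ,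
          Polynomial.eval_add, Polynomial.eval_finsetSum, Polynomial.eval_comp]
        congr 2
        · refine sum_congr rfl fun j _ => ?_
          split_ifs with hj
          · rw [hP j hj.2, Polynomial.eval_mul, Polynomial.eval_C]
          · simp
        · simp only [Polynomial.eval_add, Polynomial.eval_mul, Polynomial.eval_C,
            Polynomial.eval_X]
          ring_nf
      obtain ⟨S, hSdeg, hS⟩ := exists_polynomial_eval_eq_sum_range Q
      refine ⟨S + Polynomial.C (x i), fun h => absurd h hi.ne', fun _ => ?_, fun n => ?_⟩
      · rw [Polynomial.natDegree_add_C]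
        exact hSdeg.trans hQdeg
      · rw [Polynomial.eval_add, Polynomial.eval_C, hS]
        induction n with
        | zero => simp
        | succ n ihn =>
          rw [step, ihn, sum_range_succ]
          ring
  choose P hP0 hP1 hP using coord
  exact ⟨P, hP0, hP1, fun n i => hP i n⟩
end
end

section
/- Let g : (1,∞) → ℝ be a twice continuously differentiable function with g > 0, g′ ≥ 0 and g″ ≥ 0 on (1,∞). Fix a real number α ≠ 0. Then for Lebesgue-almost every β > 1, for every integer r ≥ 1, every choice of integers 0 ≤ l₁ < l₂ < ⋯ < l_r, and every choice of positive integers k₁,…,k_r, the sequence ( ∑_{i=1}^{r} k_i α β^{n+l_i} g(β) )_{n≥1} is uniformly distributed modulo 1. -/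
open Filter Finset

noncomputable section

/-- `(x n)_{n ≥ 1}` is uniformly distributed modulo `1`. -/
def UDMod1 (x : ℕ → ℝ) : Prop :=
  ∀ a b : ℝ, 0 ≤ a → a < b → b ≤ 1 →
    Tendsto (fun N : ℕ =>
        (((Finset.Icc 1 N).filter fun n => Int.fract (x n) ∈ Set.Icc a b).card : ℝ) / N)
      atTop (nhds (b - a))

open MeasureTheory Topology

/-- Van der Corput's first derivative test for a convex phase. -/
theorem norm_integral_cexp_le {a b w c : ℝ} (hab : a ≤ b) (hw : w ≠ 0) (hc : 0 < c)
    {ψ ψ₁ ψ₂ : ℝ → ℝ} (h₁ : ∀ x ∈ Set.Icc a b, HasDerivAt ψ (ψ₁ x) x)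
    (h₂ : ∀ x ∈ Set.Icc a b, HasDerivAt ψ₁ (ψ₂ x) x) (hcont : ContinuousOn ψ₂ (Set.Icc a b))
    (hnn : ∀ x ∈ Set.Icc a b, 0 ≤ ψ₂ x) (hlow : ∀ x ∈ Set.Icc a b, c ≤ ψ₁ x) :
    ‖∫ x in a..b, Complex.exp (Complex.I * (w * ψ x))‖ ≤ 2 / (|w| * c) := by
  have hpos : ∀ x ∈ Set.Icc a b, 0 < ψ₁ x := fun x hx => hc.trans_le (hlow x hx)
  have hψ : ContinuousOn ψ (Set.Icc a b) := fun x hx => (h₁ x hx).continuousAt.continuousWithinAt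
  have hψ₁ : ContinuousOn ψ₁ (Set.Icc a b) := fun x hx => (h₂ x hx).continuousAt.continuousWithinAt
  have hne : ∀ x ∈ Set.Icc a b, Complex.I * (w * (ψ₁ x : ℂ)) ≠ 0 := fun x hx => by
    simp [hw, (hpos x hx).ne']
  set E : ℝ → ℂ := fun x => Complex.exp (Complex.I * (w * ψ x)) with hE
  have hEn : ∀ x, ‖E x‖ = 1 := fun x => by
    simp only [hE]
    rw [← Complex.ofReal_mul, mul_comm, Complex.norm_exp_ofReal_mul_I]
  have hEc : ContinuousOn E (Set.Icc a b) := by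
    simp only [hE]
    fun_prop
  set q : ℝ → ℝ := fun x => ψ₂ x / ψ₁ x ^ 2
  have hqc : ContinuousOn q (Set.Icc a b) :=
    hcont.div (hψ₁.pow 2) fun x hx => pow_ne_zero 2 (hpos x hx).ne'
  have hF : ∀ x ∈ Set.Icc a b, HasDerivAt (fun x => E x / (Complex.I * (w * (ψ₁ x : ℂ))))
      (E x - E x * (q x : ℂ) / (Complex.I * w)) x := by
    intro x hx
    have e1 : HasDerivAt E (E x * (Complex.I * (w * (ψ₁ x : ℂ)))) x :=
      (((h₁ x hx).ofReal_comp.const_mul (w : ℂ)).const_mul Complex.I).cexp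
    have e2 := ((h₂ x hx).ofReal_comp.const_mul (w : ℂ)).const_mul Complex.I
    refine (e1.div e2 (hne x hx)).congr_deriv ?_
    have := (hpos x hx).ne'
    have hwC : (w : ℂ) ≠ 0 := by exact_mod_cast hw
    have hpC : (ψ₁ x : ℂ) ≠ 0 := by exact_mod_cast this
    simp only [q]
    push_cast
    field_simp
  have hG : ∀ x ∈ Set.Icc a b, HasDerivAt (fun x => -(ψ₁ x)⁻¹) (q x) x := by
    intro x hx
    refine ((h₂ x hx).inv (hpos x hx).ne').neg.congr_deriv ?_
    simp only [q]
    ring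
  have hu : Set.uIcc a b = Set.Icc a b := Set.uIcc_of_le hab
  have hqi : IntervalIntegrable q volume a b := (hu ▸ hqc).intervalIntegrable
  have hEi : IntervalIntegrable E volume a b := (hu ▸ hEc).intervalIntegrable
  have hEqi : IntervalIntegrable (fun x => E x * (q x : ℂ) / (Complex.I * w)) volume a b := by
    refine ContinuousOn.intervalIntegrable ?_
    rw [hu]
    have : ContinuousOn (fun x => (q x : ℂ)) (Set.Icc a b) :=
      Complex.continuous_ofReal.comp_continuousOn hqc
    exact (hEc.mul this).div_const _
  have hIE := intervalIntegral.integral_eq_sub_of_hasDerivAt (fun x hx => hF x (hu ▸ hx))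
    (hEi.sub hEqi)
  have hIq := intervalIntegral.integral_eq_sub_of_hasDerivAt (fun x hx => hG x (hu ▸ hx)) hqi
  rw [intervalIntegral.integral_sub hEi hEqi, sub_eq_iff_eq_add] at hIE
  have hIEq : ‖∫ x in a..b, E x * (q x : ℂ) / (Complex.I * w)‖ ≤ (∫ x in a..b, q x) / |w| := by
    rw [← intervalIntegral.integral_div]
    refine intervalIntegral.norm_integral_le_of_norm_le hab ?_ (hqi.div_const _)
    refine Eventually.of_forall fun x hx => ?_
    have hx' := Set.Ioc_subset_Icc_self hx
    have : 0 ≤ q x := div_nonneg (hnn x hx') (sq_nonneg _)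
    simp [hEn, abs_of_nonneg this]
  rw [hIq] at hIEq
  have ha : a ∈ Set.Icc a b := ⟨le_rfl, hab⟩
  have hb : b ∈ Set.Icc a b := ⟨hab, le_rfl⟩
  have hFn : ∀ x ∈ Set.Icc a b, ‖E x / (Complex.I * (w * (ψ₁ x : ℂ)))‖ = (ψ₁ x)⁻¹ / |w| := by
    intro x hx
    rw [norm_div, hEn]
    simp [abs_of_pos (hpos x hx)]
    ring
  have hwp : 0 < |w| := abs_pos.2 hw
  rw [hIE]
  calc _ ≤ (ψ₁ b)⁻¹ / |w| + (ψ₁ a)⁻¹ / |w| + (-(ψ₁ b)⁻¹ - -(ψ₁ a)⁻¹) / |w| := by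
        refine (norm_add_le _ _).trans (add_le_add ((norm_sub_le _ _).trans ?_) hIEq)
        rw [hFn a ha, hFn b hb]
    _ = 2 * (ψ₁ a)⁻¹ / |w| := by ring
    _ ≤ 2 * c⁻¹ / |w| := by
        have := hlow a ha
        gcongr
    _ = 2 / (|w| * c) := by field_simp

/-- For summands of norm at most `1`, Cesàro means tending to `0` along the squares tend to `0`. -/
theorem tendsto_average_of_tendsto_average_sq {u : ℕ → ℂ} (hu : ∀ n, ‖u n‖ ≤ 1)
    (h : Tendsto (fun M : ℕ => ‖∑ n ∈ Icc 1 (M ^ 2), u n‖ / (M : ℝ) ^ 2) atTop (𝓝 0)) :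
    Tendsto (fun N : ℕ => (∑ n ∈ Icc 1 N, u n) / (N : ℂ)) atTop (𝓝 0) := by
  have hs : Tendsto Nat.sqrt atTop atTop :=
    tendsto_atTop_atTop.2 fun b => ⟨b * b, fun n hn => Nat.le_sqrt.2 hn⟩
  have hlim : Tendsto (fun M : ℕ => ‖∑ n ∈ Icc 1 (M ^ 2), u n‖ / (M : ℝ) ^ 2 + 2 / (M : ℝ))
      atTop (𝓝 0) := by
    simpa using h.add (tendsto_const_div_atTop_nhds_zero_nat (2 : ℝ))
  refine squeeze_zero_norm' ?_ (hlim.comp hs)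
  filter_upwards [eventually_ge_atTop 1] with N hN
  set M := Nat.sqrt N with hM
  have hM1 : 1 ≤ M := Nat.le_sqrt.2 (by simpa using hN)
  have hle : M ^ 2 ≤ N := Nat.sqrt_le' N
  have hlt : N ≤ M ^ 2 + 2 * M := by
    have := Nat.sqrt_le_add N
    rw [← hM] at this
    nlinarith
  have hsplit : ∑ n ∈ Icc 1 N, u n = ∑ n ∈ Icc 1 (M ^ 2), u n + ∑ n ∈ Ioc (M ^ 2) N, u n := by
    have e : ∀ K, Icc 1 K = Ioc 0 K := fun K => by ext; simp [Nat.succ_le_iff]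
    rw [e, e, ← Finset.sum_union (Finset.disjoint_left.2 fun x hx hx' => by simp at hx hx'; omega),
      Finset.Ioc_union_Ioc_eq_Ioc (Nat.zero_le _) hle]
  have htail : ‖∑ n ∈ Ioc (M ^ 2) N, u n‖ ≤ 2 * M := by
    refine (norm_sum_le_of_le _ fun n _ => hu n).trans ?_
    simp only [sum_const, Nat.card_Ioc, nsmul_eq_mul, mul_one]
    exact_mod_cast Nat.sub_le_iff_le_add'.2 hlt
  have hMp : (0 : ℝ) < M := by exact_mod_cast hM1
  have hMN : (M : ℝ) ^ 2 ≤ N := by exact_mod_cast hle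
  rw [norm_div, Complex.norm_natCast, hsplit]
  calc _ ≤ (‖∑ n ∈ Icc 1 (M ^ 2), u n‖ + 2 * M) / (M : ℝ) ^ 2 :=
        div_le_div₀ (by positivity) ((norm_add_le _ _).trans (by gcongr)) (by positivity) hMN
    _ = _ := by
        simp only [Function.comp]
        rw [← hM]
        field_simp

/-- A law of large numbers for bounded, almost orthogonal sequences. -/
theorem ae_tendsto_average_of_norm_integral_le {X : Type*} [MeasurableSpace X] {ν : Measure X}
    [IsFiniteMeasure ν] {u : ℕ → X → ℂ} (hm : ∀ n, AEStronglyMeasurable (u n) ν)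
    (hu : ∀ n x, ‖u n x‖ ≤ 1) {K : ℝ}
    (hK : ∀ k n, 1 ≤ k → k < n → ‖∫ x, u n x * (starRingEnd ℂ) (u k x) ∂ν‖ ≤ K / n) :
    ∀ᵐ x ∂ν, Tendsto (fun N : ℕ => (∑ n ∈ Icc 1 N, u n x) / (N : ℂ)) atTop (𝓝 0) := by
  have hK0 : 0 ≤ K := by
    have := (norm_nonneg _).trans (hK 1 2 le_rfl one_lt_two)
    push_cast at this
    linarith
  set S : ℕ → X → ℂ := fun N x => ∑ n ∈ Icc 1 N, u n x with hS
  have hSm : ∀ N, AEStronglyMeasurable (S N) ν := fun N =>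
    Finset.aestronglyMeasurable_fun_sum _ fun n _ => hm n
  have hSb : ∀ N x, ‖S N x‖ ≤ N := fun N x => by
    refine (norm_sum_le_of_le _ fun n _ => hu n x).trans ?_
    simp
  have hS_int : ∀ N, Integrable (fun x => ‖S N x‖ ^ 2) ν := fun N =>
    Integrable.of_bound ((hSm N).norm.pow 2) ((N : ℝ) ^ 2) (Eventually.of_forall fun x => by
      rw [Real.norm_of_nonneg (by positivity)]
      exact pow_le_pow_left₀ (norm_nonneg _) (hSb N x) 2)
  have hconj : ∀ {f : X → ℂ}, AEStronglyMeasurable f ν →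
      AEStronglyMeasurable (fun x => (starRingEnd ℂ) (f x)) ν := fun hf =>
    Complex.continuous_conj.comp_aestronglyMeasurable hf
  have hcross : ∀ n k, Integrable (fun x => u n x * (starRingEnd ℂ) (u k x)) ν := fun n k =>
    Integrable.of_bound ((hm n).mul (hconj (hm k))) 1 (Eventually.of_forall fun x => by
      rw [norm_mul, RCLike.norm_conj]
      exact mul_le_one₀ (hu n x) (norm_nonneg _) (hu k x))
  have hmean : ∀ N : ℕ, ∫ x, ‖S N x‖ ^ 2 ∂ν ≤ (ν.real Set.univ + 2 * K) * N := by
    intro N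
    induction N with
    | zero => simp [hS]
    | succ N ih =>
      have hstep : ∀ x, ‖S (N + 1) x‖ ^ 2 ≤ ‖S N x‖ ^ 2 + (1 +
          2 * (∑ k ∈ Icc 1 N, u (N + 1) x * (starRingEnd ℂ) (u k x)).re) := by
        intro x
        have e : S (N + 1) x = u (N + 1) x + S N x := by
          simp only [hS]
          rw [Finset.sum_Icc_succ_top (by omega), add_comm]
        have e2 : ∑ k ∈ Icc 1 N, u (N + 1) x * (starRingEnd ℂ) (u k x) =
            u (N + 1) x * (starRingEnd ℂ) (S N x) := by
          simp only [hS]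
          rw [map_sum, Finset.mul_sum]
        rw [e, e2, Complex.sq_norm, Complex.normSq_add, ← Complex.sq_norm, ← Complex.sq_norm]
        nlinarith [hu (N + 1) x, norm_nonneg (u (N + 1) x)]
      have hci : Integrable (fun x => ∑ k ∈ Icc 1 N, u (N + 1) x * (starRingEnd ℂ) (u k x)) ν :=
        integrable_finsetSum _ fun k _ => hcross _ _
      have hcr : Integrable
          (fun x => (∑ k ∈ Icc 1 N, u (N + 1) x * (starRingEnd ℂ) (u k x)).re) ν := hci.re
      have hci' : Integrable
          (fun x => 1 + 2 * (∑ k ∈ Icc 1 N, u (N + 1) x * (starRingEnd ℂ) (u k x)).re) ν :=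
        (integrable_const _).add (hcr.const_mul 2)
      have hre : ∫ x, (∑ k ∈ Icc 1 N, u (N + 1) x * (starRingEnd ℂ) (u k x)).re ∂ν ≤ K := by
        have e3 : ∫ x, (∑ k ∈ Icc 1 N, u (N + 1) x * (starRingEnd ℂ) (u k x)).re ∂ν =
            (∫ x, ∑ k ∈ Icc 1 N, u (N + 1) x * (starRingEnd ℂ) (u k x) ∂ν).re :=
          integral_re hci
        rw [e3, integral_finsetSum _ fun k _ => hcross _ _]
        refine (Complex.re_le_norm _).trans ((norm_sum_le_of_le _ fun k hk =>
          hK k (N + 1) (mem_Icc.1 hk).1 (Nat.lt_succ_of_le (mem_Icc.1 hk).2)).trans ?_)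
        simp only [sum_const, Nat.card_Icc, nsmul_eq_mul, add_tsub_cancel_right]
        push_cast
        rw [mul_div_assoc', div_le_iff₀ (by positivity)]
        nlinarith
      calc _ ≤ ∫ x, (‖S N x‖ ^ 2 + (1 +
              2 * (∑ k ∈ Icc 1 N, u (N + 1) x * (starRingEnd ℂ) (u k x)).re)) ∂ν :=
            integral_mono (hS_int _) ((hS_int N).add hci') hstep
        _ ≤ _ := by
            rw [integral_add (hS_int N) hci', integral_add (integrable_const _) (hcr.const_mul 2),
              integral_const_mul, integral_const]
            push_cast
            simp only [smul_eq_mul, mul_one]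
            linarith
  set C := ν.real Set.univ + 2 * K
  have hC0 : 0 ≤ C := add_nonneg measureReal_nonneg (by linarith)
  have hlint : ∀ M : ℕ, ∫⁻ x, ENNReal.ofReal ((‖S (M ^ 2) x‖ / (M : ℝ) ^ 2) ^ 2) ∂ν ≤
      ENNReal.ofReal (C * (1 / (M : ℝ) ^ 2)) := by
    intro M
    have hi : Integrable (fun x => (‖S (M ^ 2) x‖ / (M : ℝ) ^ 2) ^ 2) ν := by
      simp_rw [div_pow]
      exact (hS_int _).div_const _
    rw [← ofReal_integral_eq_lintegral_ofReal hi (Eventually.of_forall fun x => by positivity)]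
    refine ENNReal.ofReal_le_ofReal ?_
    simp_rw [div_pow]
    rw [integral_div]
    rcases Nat.eq_zero_or_pos M with rfl | hM
    · simp
    have := hmean (M ^ 2)
    push_cast at this
    rw [div_le_iff₀ (by positivity)]
    refine this.trans_eq ?_
    field_simp
  have hsum : ∑' M : ℕ, ∫⁻ x, ENNReal.ofReal ((‖S (M ^ 2) x‖ / (M : ℝ) ^ 2) ^ 2) ∂ν ≠ ⊤ := by
    refine ne_top_of_le_ne_top ?_ (ENNReal.tsum_le_tsum hlint)
    exact ((Real.summable_one_div_nat_pow.2 one_lt_two).mul_left C).tsum_ofReal_ne_top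
  have hae : ∀ M : ℕ, AEMeasurable
      (fun x => ENNReal.ofReal ((‖S (M ^ 2) x‖ / (M : ℝ) ^ 2) ^ 2)) ν := fun M =>
    (((hSm _).norm.aemeasurable.div_const _).pow_const 2).ennreal_ofReal
  rw [← lintegral_tsum hae] at hsum
  filter_upwards [ae_lt_top' (AEMeasurable.tsum hae) hsum] with x hx
  refine tendsto_average_of_tendsto_average_sq (fun n => hu n x) ?_
  have h0 := ENNReal.tendsto_atTop_zero_of_tsum_ne_top hx.ne
  rw [Nat.cofinite_eq_atTop.symm] at h0
  have h1 := (ENNReal.tendsto_toReal ENNReal.zero_ne_top).comp h0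
  have h2 := (Real.continuous_sqrt.tendsto _).comp h1
  simp only [ENNReal.toReal_zero, Real.sqrt_zero, Nat.cofinite_eq_atTop] at h2
  refine h2.congr fun M => ?_
  simp only [Function.comp]
  rw [ENNReal.toReal_ofReal (by positivity), Real.sqrt_sq (by positivity)]

/-- The uniform probability measure on the points `x 1, …, x (N + 1)`. -/
def empiricalMeasure {X : Type*} [MeasurableSpace X] (x : ℕ → X) (N : ℕ) : ProbabilityMeasure X :=
  ⟨((N + 1 : ℕ) : ENNReal)⁻¹ • ∑ n ∈ Icc 1 (N + 1), Measure.dirac (x n), ⟨by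
    simp only [Measure.smul_apply, Measure.finsetSum_apply, measure_univ, sum_const,
      Nat.card_Icc, nsmul_eq_mul, mul_one, smul_eq_mul, add_tsub_cancel_right]
    exact ENNReal.inv_mul_cancel (by simp) (ENNReal.natCast_ne_top _)⟩⟩

theorem coe_empiricalMeasure {X : Type*} [MeasurableSpace X] (x : ℕ → X) (N : ℕ) :
    (empiricalMeasure x N : Measure X) =
      ((N + 1 : ℕ) : ENNReal)⁻¹ • ∑ n ∈ Icc 1 (N + 1), Measure.dirac (x n) := rfl

theorem integral_empiricalMeasure {X : Type*} [MeasurableSpace X] [MeasurableSingletonClass X]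
    (x : ℕ → X) (N : ℕ) (f : X → ℂ) :
    ∫ y, f y ∂(empiricalMeasure x N : Measure X) =
      (∑ n ∈ Icc 1 (N + 1), f (x n)) / ((N + 1 : ℕ) : ℂ) := by
  rw [coe_empiricalMeasure, integral_smul_measure,
    integral_finsetSum_measure fun n _ => integrable_dirac (by simp)]
  simp only [integral_dirac, ENNReal.toReal_inv, ENNReal.toReal_natCast, Complex.real_smul]
  push_cast
  rw [div_eq_inv_mul]

theorem empiricalMeasure_apply_toReal {X : Type*} [MeasurableSpace X] (x : ℕ → X) (N : ℕ)
    {s : Set X} [DecidablePred (· ∈ s)] (hs : MeasurableSet s) :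
    ((empiricalMeasure x N : Measure X) s).toReal =
      (#{n ∈ Icc 1 (N + 1) | x n ∈ s} : ℝ) / ((N + 1 : ℕ) : ℝ) := by
  rw [coe_empiricalMeasure, Measure.smul_apply, Measure.finsetSum_apply, smul_eq_mul,
    ENNReal.toReal_mul, ENNReal.toReal_inv, ENNReal.toReal_natCast, div_eq_inv_mul]
  congr 1
  simp only [Measure.dirac_apply' _ hs, Set.indicator_apply, Pi.one_apply]
  rw [← Finset.sum_filter]
  simp

/-- Weyl's criterion as weak convergence of empirical measures on the circle. -/
theorem tendsto_empiricalMeasure_unitAddCircle {x : ℕ → UnitAddCircle}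
    (h : ∀ m : ℤ, m ≠ 0 →
      Tendsto (fun N : ℕ => (∑ n ∈ Icc 1 N, fourier m (x n)) / (N : ℂ)) atTop (𝓝 0)) :
    Tendsto (empiricalMeasure x) atTop
      (𝓝 (⟨volume, ⟨by simp⟩⟩ : ProbabilityMeasure UnitAddCircle)) := by
  set A : StarSubalgebra ℂ (BoundedContinuousFunction UnitAddCircle ℂ) :=
    (fourierSubalgebra (T := 1)).comap (BoundedContinuousFunction.toContinuousMapStarₐ ℂ)
  refine ProbabilityMeasure.tendsto_of_tight_of_separatesPoints ℂ (A := A)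
    IsTightMeasureSet.of_compactSpace ?_ ?_
  · intro y z hyz
    obtain ⟨_, ⟨f, hf, rfl⟩, hne⟩ := fourierSubalgebra_separatesPoints (T := 1) hyz
    exact ⟨f, ⟨f, ⟨BoundedContinuousFunction.mkOfCompact f, hf, rfl⟩, rfl⟩, hne⟩
  · intro f hf
    have hmem : f.toContinuousMap ∈ Submodule.span ℂ (Set.range (fourier (T := 1))) := by
      rw [← fourierSubalgebra_coe]
      exact hf
    suffices H : ∀ φ ∈ Submodule.span ℂ (Set.range (fourier (T := 1))),
        Tendsto (fun N => ∫ y, φ y ∂(empiricalMeasure x N : Measure UnitAddCircle)) atTop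
          (𝓝 (∫ y, φ y)) from H _ hmem
    intro φ hφ
    have hi : ∀ (μ : Measure UnitAddCircle) [IsFiniteMeasure μ] (φ : C(UnitAddCircle, ℂ)),
        Integrable (fun y => φ y) μ := fun μ _ φ =>
      (BoundedContinuousFunction.mkOfCompact φ).integrable μ
    induction hφ using Submodule.span_induction with
    | mem φ hφ =>
      obtain ⟨m, rfl⟩ := hφ
      simp_rw [integral_empiricalMeasure]
      rcases eq_or_ne m 0 with rfl | hm
      · simp only [fourier_zero, sum_const, Nat.card_Icc, add_tsub_cancel_right, nsmul_eq_mul,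
          mul_one, integral_const]
        refine tendsto_const_nhds.congr fun N => ?_
        rw [div_self (by exact_mod_cast N.succ_ne_zero)]
        simp [Measure.real]
      · have h0 : ∫ y : UnitAddCircle, fourier m y = 0 := by
          have := integral_eq_zero_of_add_right_eq_neg (μ := (volume : Measure UnitAddCircle))
            (fourier_add_half_inv_index hm one_pos)
          exact this
        rw [h0]
        exact (tendsto_add_atTop_iff_nat 1).2 (h m hm)
    | zero => simp
    | add φ χ _ _ h1 h2 =>
      simp only [ContinuousMap.add_apply]
      rw [integral_add (hi _ φ) (hi _ χ)]
      exact (h1.add h2).congr fun N => (integral_add (hi _ φ) (hi _ χ)).symm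
    | smul c φ _ h1 =>
      simp only [ContinuousMap.smul_apply, integral_smul]
      exact h1.const_smul c

/-- Weyl's criterion. -/
theorem UDMod1.of_tendsto_cexp {x : ℕ → ℝ}
    (h : ∀ m : ℤ, m ≠ 0 → Tendsto (fun N : ℕ =>
      (∑ n ∈ Icc 1 N, Complex.exp (Complex.I * ((2 * Real.pi * m : ℝ) * x n))) / (N : ℂ))
        atTop (𝓝 0)) : UDMod1 x := by
  intro a b ha hab hb
  have hw := tendsto_empiricalMeasure_unitAddCircle (x := fun n => (x n : UnitAddCircle))
    fun m hm => by
      refine (h m hm).congr fun N => ?_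
      congr 1
      refine sum_congr rfl fun n _ => ?_
      rw [fourier_coe_apply]
      congr 1
      push_cast
      ring
  set E : Set UnitAddCircle := {y | (AddCircle.equivIco 1 0 y : ℝ) ∈ Set.Icc a b}
  have hmk : Continuous ((↑) : ℝ → UnitAddCircle) := AddCircle.continuous_mk' 1
  have hmem : ∀ y : ℝ, (y : UnitAddCircle) ∈ E ↔ Int.fract y ∈ Set.Icc a b := by
    intro y
    have := AddCircle.coe_equivIco_mk_apply (p := (1 : ℝ)) y
    rw [div_one, mul_one] at this
    rw [← this]
    rfl
  have hmeas : MeasurableSet E :=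
    (measurable_subtype_coe.comp (AddCircle.measurableEquivIco 1 0).measurable) measurableSet_Icc
  have hsub : E ⊆ (↑) '' Set.Icc a b := fun y hy =>
    ⟨_, hy, (AddCircle.equivIco 1 0).symm_apply_apply y⟩
  have hsup : (↑) '' Set.Ioo a b ⊆ E := by
    rintro _ ⟨y, hy, rfl⟩
    rw [hmem, Int.fract_eq_self.2 ⟨ha.trans hy.1.le, hy.2.trans_le hb⟩]
    exact Set.Ioo_subset_Icc_self hy
  have hfr : frontier E ⊆ {(a : UnitAddCircle), (b : UnitAddCircle)} := by
    intro y hy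
    obtain ⟨t, ht, rfl⟩ := closure_minimal hsub (isCompact_Icc.image hmk).isClosed hy.1
    rcases eq_or_lt_of_le ht.1 with rfl | h1
    · exact Or.inl rfl
    rcases eq_or_lt_of_le ht.2 with rfl | h2
    · exact Or.inr rfl
    exact absurd (interior_maximal hsup (QuotientAddGroup.isOpenMap_coe _ isOpen_Ioo)
      ⟨t, ⟨h1, h2⟩, rfl⟩) hy.2
  have hvol : volume E = ENNReal.ofReal (b - a) := by
    rw [AddCircle.add_projection_respects_measure 1 0 hmeas, ← Real.volume_Icc, zero_add]
    have hset : (QuotientAddGroup.mk ⁻¹' E ∩ Set.Ioc 0 1 : Set ℝ) =ᵐ[volume] Set.Icc a b := by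
      have h0 : ∀ᵐ y : ℝ, y ≠ 0 := by simp [ae_iff]
      have h1 : ∀ᵐ y : ℝ, y ≠ 1 := by simp [ae_iff]
      filter_upwards [h0, h1] with y hy0 hy1
      refine propext ⟨fun hy => ?_, fun hy => ?_⟩
      · have := (hmem y).1 hy.1
        rwa [Int.fract_eq_self.2 ⟨hy.2.1.le, lt_of_le_of_ne hy.2.2 hy1⟩] at this
      · have hlt : y < 1 := lt_of_le_of_ne (hy.2.trans hb) hy1
        have hge : 0 ≤ y := ha.trans hy.1
        refine ⟨(hmem y).2 ?_, lt_of_le_of_ne hge hy0.symm, hlt.le⟩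
        rwa [Int.fract_eq_self.2 ⟨hge, hlt⟩]
    exact measure_congr hset
  have hpt : ∀ y : UnitAddCircle, volume {y} = 0 := fun y => by
    simpa using AddCircle.volume_closedBall 1 (x := y) 0
  have hnull : volume (frontier E) = 0 :=
    measure_mono_null hfr (measure_union_null (hpt _) (hpt _))
  have hlim := (ENNReal.tendsto_toReal (by simp [hvol])).comp
    (ProbabilityMeasure.tendsto_measure_of_null_frontier_of_tendsto' hw hnull)
  classical
  rw [← tendsto_add_atTop_iff_nat 1]
  have hba : (volume E).toReal = b - a := by
    rw [hvol, ENNReal.toReal_ofReal (by linarith)]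
  rw [← hba]
  refine hlim.congr fun N => ?_
  simp only [Function.comp]
  rw [empiricalMeasure_apply_toReal _ _ hmeas]
  simp only [hmem]

/-- For `h > 0` increasing and convex beyond `1`, the exponential integrals of
`(x ^ n - x ^ k) h x` over a compact interval in `(1, ∞)` are `O(1 / n)`. -/
theorem exists_norm_integral_cexp_pow_sub_le {h h₁ h₂ : ℝ → ℝ}
    (hd : ∀ x ∈ Set.Ioi (1 : ℝ), HasDerivAt h (h₁ x) x)
    (hd' : ∀ x ∈ Set.Ioi (1 : ℝ), HasDerivAt h₁ (h₂ x) x)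
    (hc : ContinuousOn h₂ (Set.Ioi 1)) (hpos : ∀ x ∈ Set.Ioi (1 : ℝ), 0 < h x)
    (hnn₁ : ∀ x ∈ Set.Ioi (1 : ℝ), 0 ≤ h₁ x) (hnn₂ : ∀ x ∈ Set.Ioi (1 : ℝ), 0 ≤ h₂ x)
    {w a b : ℝ} (hw : w ≠ 0) (ha : 1 < a) (hab : a ≤ b) :
    ∃ K : ℝ, ∀ k n : ℕ, 1 ≤ k → k < n →
      ‖∫ x in a..b, Complex.exp (Complex.I * (w * ((x ^ n - x ^ k) * h x : ℝ)))‖ ≤ K / n := by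
  have hsub : ∀ x ∈ Set.Icc a b, x ∈ Set.Ioi (1 : ℝ) := fun x hx => ha.trans_le hx.1
  have hmono : MonotoneOn h (Set.Ioi 1) := by
    refine monotoneOn_of_deriv_nonneg (convex_Ioi 1)
      (fun x hx => (hd x hx).continuousAt.continuousWithinAt)
      (fun x hx => ?_) fun x hx => ?_
    all_goals rw [interior_Ioi] at hx
    · exact (hd x hx).differentiableAt.differentiableWithinAt
    · rw [(hd x hx).deriv]
      exact hnn₁ x hx
  have hh : 0 < h a := hpos a ha
  have ha0 : 0 < a - 1 := sub_pos.2 ha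
  refine ⟨2 / (|w| * ((a - 1) * h a)), fun k n hk hkn => ?_⟩
  have hn : (0 : ℝ) < n := by exact_mod_cast (Nat.zero_lt_of_lt hkn)
  have key := norm_integral_cexp_le (ψ := fun x => (x ^ n - x ^ k) * h x)
    (ψ₁ := fun x => (n * x ^ (n - 1) - k * x ^ (k - 1)) * h x + (x ^ n - x ^ k) * h₁ x)
    (ψ₂ := fun x => (n * ((n - 1 : ℕ) * x ^ (n - 1 - 1)) - k * ((k - 1 : ℕ) * x ^ (k - 1 - 1))) * h x
      + (n * x ^ (n - 1) - k * x ^ (k - 1)) * h₁ x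
      + ((n * x ^ (n - 1) - k * x ^ (k - 1)) * h₁ x + (x ^ n - x ^ k) * h₂ x))
    (c := n * ((a - 1) * h a)) hab hw (by positivity) ?_ ?_ ?_ ?_ ?_
  · refine key.trans_eq ?_
    have := abs_pos.2 hw
    field_simp
  · intro x hx
    exact ((hasDerivAt_pow n x).sub (hasDerivAt_pow k x)).mul (hd x (hsub x hx))
  · intro x hx
    exact ((((hasDerivAt_pow (n - 1) x).const_mul (n : ℝ)).sub
      ((hasDerivAt_pow (k - 1) x).const_mul (k : ℝ))).mul (hd x (hsub x hx))).add
      (((hasDerivAt_pow n x).sub (hasDerivAt_pow k x)).mul (hd' x (hsub x hx)))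
  · have c0 : ContinuousOn h (Set.Icc a b) := fun x hx =>
      (hd x (hsub x hx)).continuousAt.continuousWithinAt
    have c1 : ContinuousOn h₁ (Set.Icc a b) := fun x hx =>
      (hd' x (hsub x hx)).continuousAt.continuousWithinAt
    have c2 : ContinuousOn h₂ (Set.Icc a b) := hc.mono hsub
    fun_prop
  all_goals
    intro x hx
    have hx1 := hsub x hx
    have hx1' : 1 ≤ x := le_of_lt hx1
    have hkn' : (k : ℝ) ≤ n := by exact_mod_cast hkn.le
    have p0 : 0 ≤ x ^ n - x ^ k := sub_nonneg.2 (pow_le_pow_right₀ hx1' hkn.le)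
    have q1 := hnn₁ x hx1
    have q2 := hnn₂ x hx1
    have q0 := (hpos x hx1).le
  · have p1 : 0 ≤ n * x ^ (n - 1) - k * x ^ (k - 1) := by
      rw [sub_nonneg]
      gcongr
    have p2 : 0 ≤ n * ((n - 1 : ℕ) * x ^ (n - 1 - 1)) - k * ((k - 1 : ℕ) * x ^ (k - 1 - 1)) := by
      rw [sub_nonneg]
      gcongr
    positivity
  · have e1 : (n : ℝ) * (a - 1) ≤ n * x ^ (n - 1) - k * x ^ (k - 1) := by
      have l1 : (k : ℝ) * x ^ (k - 1) ≤ n * x ^ (n - 1 - 1) := by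
        gcongr
        omega
      have l2 : x ^ (n - 1) = x ^ (n - 1 - 1) * x := by
        rw [← pow_succ]
        congr 1
        omega
      have l3 : 1 ≤ x ^ (n - 1 - 1) := one_le_pow₀ hx1'
      have l4 : a - 1 ≤ x ^ (n - 1 - 1) * (x - 1) := by
        nlinarith [hx.1]
      nlinarith
    have e2 : h a ≤ h x := hmono ha hx1 hx.1
    calc (n : ℝ) * ((a - 1) * h a) = n * (a - 1) * h a := by ring
      _ ≤ (n * x ^ (n - 1) - k * x ^ (k - 1)) * h x := by
          have : (0 : ℝ) ≤ n * (a - 1) := by positivity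
          gcongr
          exact this.trans e1
      _ ≤ _ := le_add_of_nonneg_right (mul_nonneg p0 q1)

/-- Koksma's theorem for `α xⁿ h(x)`. -/
theorem ae_udMod1_mul_pow_mul {h h₁ h₂ : ℝ → ℝ}
    (hd : ∀ x ∈ Set.Ioi (1 : ℝ), HasDerivAt h (h₁ x) x)
    (hd' : ∀ x ∈ Set.Ioi (1 : ℝ), HasDerivAt h₁ (h₂ x) x)
    (hc : ContinuousOn h₂ (Set.Ioi 1)) (hpos : ∀ x ∈ Set.Ioi (1 : ℝ), 0 < h x)
    (hnn₁ : ∀ x ∈ Set.Ioi (1 : ℝ), 0 ≤ h₁ x) (hnn₂ : ∀ x ∈ Set.Ioi (1 : ℝ), 0 ≤ h₂ x)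
    {α : ℝ} (hα : α ≠ 0) :
    ∀ᵐ x, 1 < x → UDMod1 fun n => α * (x ^ n * h x) := by
  have main : ∀ (m : ℤ) (p : ℕ), m ≠ 0 → ∀ᵐ x, x ∈ Set.Ioc (1 + 1 / ((p : ℝ) + 1)) (p + 2) →
      Tendsto (fun N : ℕ => (∑ n ∈ Icc 1 N, Complex.exp
        (Complex.I * ((2 * Real.pi * m : ℝ) * (α * (x ^ n * h x) : ℝ)))) / (N : ℂ)) atTop (𝓝 0) := by
    intro m p hm
    set a : ℝ := 1 + 1 / ((p : ℝ) + 1)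
    set b : ℝ := p + 2
    have ha : 1 < a := lt_add_of_pos_right _ (by positivity)
    have hab : a ≤ b := by
      have : 1 / ((p : ℝ) + 1) ≤ 1 := by
        rw [div_le_one (by positivity)]
        linarith [p.cast_nonneg (α := ℝ)]
      simp only [a, b]
      linarith [p.cast_nonneg (α := ℝ)]
    have hw : 2 * Real.pi * m * α ≠ 0 := by
      have := Real.pi_ne_zero
      have : (m : ℝ) ≠ 0 := by exact_mod_cast hm
      positivity
    obtain ⟨K, hK⟩ := exists_norm_integral_cexp_pow_sub_le hd hd' hc hpos hnn₁ hnn₂ hw ha hab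
    rw [← ae_restrict_iff' measurableSet_Ioc]
    have hh : ContinuousOn h (Set.Ioc a b) := fun x hx =>
      (hd x (ha.trans hx.1)).continuousAt.continuousWithinAt
    refine ae_tendsto_average_of_norm_integral_le (K := K) (u := fun n x => Complex.exp
      (Complex.I * ((2 * Real.pi * m : ℝ) * (α * (x ^ n * h x) : ℝ)))) (fun n => ?_)
      (fun n x => ?_) fun k n hk hkn => ?_
    · refine ContinuousOn.aestronglyMeasurable ?_ measurableSet_Ioc
      have : ContinuousOn (fun x => ((α * (x ^ n * h x) : ℝ) : ℂ)) (Set.Ioc a b) :=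
        Complex.continuous_ofReal.comp_continuousOn (by fun_prop)
      fun_prop
    · rw [← Complex.ofReal_mul, mul_comm, Complex.norm_exp_ofReal_mul_I]
    · refine le_of_eq_of_le ?_ (hK k n hk hkn)
      rw [intervalIntegral.integral_of_le hab]
      congr 1
      refine integral_congr_ae (Eventually.of_forall fun x => ?_)
      dsimp only
      rw [← Complex.exp_conj, ← Complex.exp_add]
      congr 1
      simp only [map_mul, Complex.conj_I, Complex.conj_ofReal]
      push_cast
      ring
  have main' : ∀ᵐ x : ℝ, ∀ (m : ℤ) (p : ℕ), m ≠ 0 →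
      x ∈ Set.Ioc (1 + 1 / ((p : ℝ) + 1)) (p + 2) →
      Tendsto (fun N : ℕ => (∑ n ∈ Icc 1 N, Complex.exp
        (Complex.I * ((2 * Real.pi * m : ℝ) * (α * (x ^ n * h x) : ℝ)))) / (N : ℂ)) atTop (𝓝 0) := by
    simp only [ae_all_iff]
    exact main
  filter_upwards [main'] with x hx hx1
  obtain ⟨p, hp⟩ := exists_nat_one_div_lt (sub_pos.2 hx1)
  obtain ⟨q, hq⟩ := exists_nat_ge x
  refine UDMod1.of_tendsto_cexp fun m hm => hx m (max p q) hm ⟨?_, ?_⟩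
  · have : 1 / (((max p q : ℕ) : ℝ) + 1) ≤ 1 / ((p : ℝ) + 1) := by
      gcongr
      exact le_max_left _ _
    linarith
  · have : (q : ℝ) ≤ ((max p q : ℕ) : ℝ) := by exact_mod_cast le_max_right p q
    linarith

/-- Let `g` be a positive `C²` function on `(1, ∞)` with `g' ≥ 0` and
`g'' ≥ 0`, and fix `α ≠ 0`.  For Lebesgue-almost every `β > 1`, for every `r ≥ 1`, every
strictly increasing tuple of nonnegative integers `l₁ < ⋯ < l_r` and all positive
integers `k₁, …, k_r`, the sequence `( ∑ᵢ kᵢ α β^{n + lᵢ} g(β) )_{n ≥ 1}` is uniformly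
distributed modulo `1`. -/
theorem ae_uniformly_distributed_power_sequence
    (g : ℝ → ℝ) (hsm : ContDiffOn ℝ 2 g (Set.Ioi 1))
    (hpos : ∀ x ∈ Set.Ioi (1 : ℝ), 0 < g x)
    (hd1 : ∀ x ∈ Set.Ioi (1 : ℝ), 0 ≤ deriv g x)
    (hd2 : ∀ x ∈ Set.Ioi (1 : ℝ), 0 ≤ deriv (deriv g) x)
    (α : ℝ) (hα : α ≠ 0) :
    ∀ᵐ β ∂MeasureTheory.volume, 1 < β →
      ∀ r : ℕ, 1 ≤ r → ∀ l : Fin r → ℕ, StrictMono l →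
        ∀ kk : Fin r → ℕ, (∀ i, 1 ≤ kk i) →
          UDMod1 (fun n => ∑ i : Fin r, (kk i : ℝ) * (α * β ^ (n + l i) * g β)) := by
  have hopen : IsOpen (Set.Ioi (1 : ℝ)) := isOpen_Ioi
  have hsm₁ : ContDiffOn ℝ 1 (deriv g) (Set.Ioi 1) := hsm.deriv_of_isOpen hopen (by norm_num)
  have hsm₂ : ContDiffOn ℝ 0 (deriv (deriv g)) (Set.Ioi 1) :=
    hsm₁.deriv_of_isOpen hopen (by norm_num)
  have hg : ∀ x ∈ Set.Ioi (1 : ℝ), HasDerivAt g (deriv g x) x := fun x hx =>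
    ((hsm.differentiableOn (by norm_num)).differentiableAt (hopen.mem_nhds hx)).hasDerivAt
  have hg' : ∀ x ∈ Set.Ioi (1 : ℝ), HasDerivAt (deriv g) (deriv (deriv g) x) x := fun x hx =>
    ((hsm₁.differentiableOn (by norm_num)).differentiableAt (hopen.mem_nhds hx)).hasDerivAt
  have main : ∀ (r : ℕ) (l kk : Fin r → ℕ), 1 ≤ r → (∀ i, 1 ≤ kk i) → ∀ᵐ β : ℝ, 1 < β →
      UDMod1 (fun n => ∑ i : Fin r, (kk i : ℝ) * (α * β ^ (n + l i) * g β)) := by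
    intro r l kk hr hkk
    set P : ℝ → ℝ := fun x => ∑ i, (kk i : ℝ) * x ^ l i
    set P₁ : ℝ → ℝ := fun x => ∑ i, (kk i : ℝ) * (l i * x ^ (l i - 1))
    set P₂ : ℝ → ℝ := fun x => ∑ i, (kk i : ℝ) * (l i * ((l i - 1 : ℕ) * x ^ (l i - 1 - 1)))
    have hP : ∀ x, HasDerivAt P (P₁ x) x := fun x =>
      HasDerivAt.fun_sum fun i _ => (hasDerivAt_pow (l i) x).const_mul _
    have hP₁ : ∀ x, HasDerivAt P₁ (P₂ x) x := fun x =>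
      HasDerivAt.fun_sum fun i _ => ((hasDerivAt_pow (l i - 1) x).const_mul _).const_mul _
    have hPpos : ∀ x ∈ Set.Ioi (1 : ℝ), 0 < P x := fun x hx => by
      have : Nonempty (Fin r) := ⟨⟨0, hr⟩⟩
      have hx0 : (0 : ℝ) < x := one_pos.trans hx
      refine Finset.sum_pos (fun i _ => ?_) Finset.univ_nonempty
      have : (0 : ℝ) < kk i := by exact_mod_cast hkk i
      positivity
    have hP₁nn : ∀ x ∈ Set.Ioi (1 : ℝ), 0 ≤ P₁ x := fun x hx => by
      have hx0 : (0 : ℝ) < x := one_pos.trans hx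
      positivity
    have hP₂nn : ∀ x ∈ Set.Ioi (1 : ℝ), 0 ≤ P₂ x := fun x hx => by
      have hx0 : (0 : ℝ) < x := one_pos.trans hx
      positivity
    have c0 : ContinuousOn g (Set.Ioi 1) := hsm.continuousOn
    have c1 : ContinuousOn (deriv g) (Set.Ioi 1) := hsm₁.continuousOn
    have c2 : ContinuousOn (deriv (deriv g)) (Set.Ioi 1) := hsm₂.continuousOn
    have key := ae_udMod1_mul_pow_mul (h := fun x => P x * g x)
      (h₁ := fun x => P₁ x * g x + P x * deriv g x)
      (h₂ := fun x => P₂ x * g x + P₁ x * deriv g x +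
        (P₁ x * deriv g x + P x * deriv (deriv g) x))
      (fun x hx => (hP x).mul (hg x hx))
      (fun x hx => ((hP₁ x).mul (hg x hx)).add ((hP x).mul (hg' x hx)))
      (by fun_prop)
      (fun x hx => mul_pos (hPpos x hx) (hpos x hx))
      (fun x hx => by
        have := hpos x hx; have := hd1 x hx; have := hPpos x hx; have := hP₁nn x hx
        positivity)
      (fun x hx => by
        have := hpos x hx; have := hd1 x hx; have := hd2 x hx
        have := hPpos x hx; have := hP₁nn x hx; have := hP₂nn x hx
        positivity) hα
    filter_upwards [key] with β hβ hβ1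
    convert! hβ hβ1 using 2 with n
    simp only [P, Finset.sum_mul, Finset.mul_sum]
    refine Finset.sum_congr rfl fun i _ => ?_
    rw [pow_add]
    ring
  have main' : ∀ᵐ β : ℝ, ∀ (r : ℕ) (l kk : Fin r → ℕ), 1 ≤ r → (∀ i, 1 ≤ kk i) → 1 < β →
      UDMod1 (fun n => ∑ i : Fin r, (kk i : ℝ) * (α * β ^ (n + l i) * g β)) := by
    simp only [ae_all_iff]
    exact main
  filter_upwards [main'] with β hβ hβ1 r hr l _ kk hkk
  exact hβ r l kk hr hkk hβ1
end
end

section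
/- Let g : (1,∞) → ℝ be a twice continuously differentiable function with g > 0, g′ ≥ 0 and g″ ≥ 0. Fix an integer r ≥ 1, integers 0 ≤ l₁ < l₂ < ⋯ < l_r, and positive integers k₁,…,k_r, and set G(x) = g(x) ∑_{i=1}^{r} k_i x^{l_i} and y_n(x) = G(x) xⁿ for n ≥ 1. Then for all real numbers 1 < a < η: (i) for all integers n > m ≥ 1, the function y_n′ − y_m′ is monotone increasing on [a, η]; and (ii) there exists L > 0 such that y_n′(x) − y_m′(x) ≥ L for all integers n > m ≥ 1 and all x ∈ [a, η]. -/
open Finset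

noncomputable section

theorem monotoneOn_pow_sub_pow {m n : ℕ} (hmn : m ≤ n) :
    MonotoneOn (fun x : ℝ => x ^ n - x ^ m) (Set.Ioi 1) := by
  intro x hx y hy hxy
  rw [Set.mem_Ioi] at hx hy
  obtain ⟨d, rfl⟩ := Nat.exists_eq_add_of_le hmn
  have h1 : x ^ m ≤ y ^ m := by gcongr
  have h2 : x ^ d ≤ y ^ d := by gcongr
  have h3 : 1 ≤ x ^ d := one_le_pow₀ hx.le
  have h4 : 0 ≤ y ^ m := by positivity
  have := mul_le_mul h1 (sub_le_sub_right h2 1) (sub_nonneg.2 h3) h4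
  simp only [pow_add]
  linarith

theorem one_le_mul_pow_sub_mul_pow {m n : ℕ} (hm : 1 ≤ m) (hmn : m < n) {x : ℝ} (hx : 1 < x) :
    1 ≤ (n : ℝ) * x ^ (n - 1) - (m : ℝ) * x ^ (m - 1) := by
  have h1 : x ^ (m - 1) ≤ x ^ (n - 1) := pow_le_pow_right₀ hx.le (by omega)
  have h2 : 1 ≤ x ^ (n - 1) := one_le_pow₀ hx.le
  have h3 : (m : ℝ) + 1 ≤ n := by exact_mod_cast hmn
  have h4 : (m : ℝ) * x ^ (m - 1) ≤ m * x ^ (n - 1) := by gcongr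
  nlinarith

theorem monotoneOn_mul_pow_sub_mul_pow {m n : ℕ} (hmn : m < n) :
    MonotoneOn (fun x : ℝ => (n : ℝ) * x ^ (n - 1) - (m : ℝ) * x ^ (m - 1)) (Set.Ioi 1) := by
  intro x hx y hy hxy
  have h1 := monotoneOn_pow_sub_pow (show m - 1 ≤ n - 1 by omega) hx hy hxy
  rw [Set.mem_Ioi] at hx
  have h2 : x ^ (n - 1) ≤ y ^ (n - 1) := by gcongr
  have h3 : (m : ℝ) ≤ n := by exact_mod_cast hmn.le
  have h4 : (0 : ℝ) ≤ m := by positivity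
  simp only at h1 ⊢
  nlinarith [mul_le_mul_of_nonneg_left h1 h4, mul_le_mul_of_nonneg_left h2 (sub_nonneg.2 h3)]

/-- For a nonnegative, nondecreasing function `G` on `(1, ∞)` with nonnegative, nondecreasing
derivative, the differences of the derivatives of `G x * x ^ n` are nondecreasing
and bounded below by `G`. -/
theorem deriv_mul_pow_sub_deriv_mul_pow {G G' : ℝ → ℝ}
    (hG : ∀ x ∈ Set.Ioi (1 : ℝ), HasDerivAt G (G' x) x)
    (hG0 : ∀ x ∈ Set.Ioi (1 : ℝ), 0 ≤ G x) (hG'0 : ∀ x ∈ Set.Ioi (1 : ℝ), 0 ≤ G' x)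
    (hGm : MonotoneOn G (Set.Ioi 1)) (hG'm : MonotoneOn G' (Set.Ioi 1))
    {m n : ℕ} (hm : 1 ≤ m) (hmn : m < n) :
    MonotoneOn (fun x => deriv (fun t => G t * t ^ n) x - deriv (fun t => G t * t ^ m) x)
      (Set.Ioi 1) ∧
    ∀ x ∈ Set.Ioi (1 : ℝ),
      G x ≤ deriv (fun t => G t * t ^ n) x - deriv (fun t => G t * t ^ m) x := by
  have hd (k : ℕ) (x : ℝ) (hx : x ∈ Set.Ioi (1 : ℝ)) :
      deriv (fun t => G t * t ^ k) x = G' x * x ^ k + G x * (k * x ^ (k - 1)) :=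
    ((hG x hx).mul (hasDerivAt_pow k x)).deriv
  have heq : Set.EqOn
      (fun x => G' x * (x ^ n - x ^ m) + G x * (n * x ^ (n - 1) - m * x ^ (m - 1)))
      (fun x => deriv (fun t => G t * t ^ n) x - deriv (fun t => G t * t ^ m) x)
      (Set.Ioi 1) := fun x hx => by
    simp only [hd n x hx, hd m x hx]
    ring
  have hpow (x : ℝ) (hx : x ∈ Set.Ioi (1 : ℝ)) : 0 ≤ x ^ n - x ^ m :=
    sub_nonneg.2 (pow_le_pow_right₀ (le_of_lt hx) hmn.le)
  have hone (x : ℝ) (hx : x ∈ Set.Ioi (1 : ℝ)) :=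
    one_le_mul_pow_sub_mul_pow hm hmn (Set.mem_Ioi.1 hx)
  refine ⟨MonotoneOn.congr ?_ heq, fun x hx => ?_⟩
  · exact (hG'm.mul (monotoneOn_pow_sub_pow hmn.le) hG'0 hpow).add
      (hGm.mul (monotoneOn_mul_pow_sub_mul_pow hmn) hG0
        fun x hx => zero_le_one.trans (hone x hx))
  · refine le_of_le_of_eq ?_ (heq hx)
    have h1 := mul_nonneg (hG'0 x hx) (hpow x hx)
    have h2 := mul_le_mul_of_nonneg_left (hone x hx) (hG0 x hx)
    simp only
    linarith

/-- With `G(x) = g(x) ∑ᵢ kᵢ x^{lᵢ}` and `y_n(x) = G(x) xⁿ`, on every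
interval `[a, η] ⊂ (1, ∞)`: (i) `y_n' - y_m'` is monotone increasing for `n > m ≥ 1`, and
(ii) there is `L > 0` with `y_n'(x) - y_m'(x) ≥ L` for all `n > m ≥ 1` and `x ∈ [a, η]`. -/
theorem koksma_hypotheses_for_power_family
    (g : ℝ → ℝ) (hsm : ContDiffOn ℝ 2 g (Set.Ioi 1))
    (hpos : ∀ x ∈ Set.Ioi (1 : ℝ), 0 < g x)
    (hd1 : ∀ x ∈ Set.Ioi (1 : ℝ), 0 ≤ deriv g x)
    (hd2 : ∀ x ∈ Set.Ioi (1 : ℝ), 0 ≤ deriv (deriv g) x)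
    (r : ℕ) (hr : 1 ≤ r) (l : Fin r → ℕ) (hl : StrictMono l)
    (kk : Fin r → ℕ) (hkk : ∀ i, 1 ≤ kk i)
    (a η : ℝ) (ha : 1 < a) (haη : a < η) :
    (∀ m n : ℕ, 1 ≤ m → m < n →
      MonotoneOn (fun x : ℝ =>
          deriv (fun t : ℝ => (g t * ∑ i : Fin r, (kk i : ℝ) * t ^ (l i)) * t ^ n) x -
          deriv (fun t : ℝ => (g t * ∑ i : Fin r, (kk i : ℝ) * t ^ (l i)) * t ^ m) x)
        (Set.Icc a η)) ∧
    ∃ L : ℝ, 0 < L ∧ ∀ m n : ℕ, 1 ≤ m → m < n → ∀ x ∈ Set.Icc a η,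
      L ≤ deriv (fun t : ℝ => (g t * ∑ i : Fin r, (kk i : ℝ) * t ^ (l i)) * t ^ n) x -
          deriv (fun t : ℝ => (g t * ∑ i : Fin r, (kk i : ℝ) * t ^ (l i)) * t ^ m) x := by
  set P : ℝ → ℝ := fun t => ∑ i : Fin r, (kk i : ℝ) * t ^ (l i) with hP
  set P' : ℝ → ℝ := fun t => ∑ i : Fin r, (kk i : ℝ) * ((l i : ℝ) * t ^ (l i - 1)) with hP'
  have hsub : Set.Icc a η ⊆ Set.Ioi 1 := fun x hx => ha.trans_le hx.1
  have hPd (x : ℝ) : HasDerivAt P (P' x) x :=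
    HasDerivAt.fun_sum fun i _ => (hasDerivAt_pow (l i) x).const_mul (kk i : ℝ)
  have hPm : MonotoneOn P (Set.Ioi 1) := fun x hx y _ hxy => by
    have : (0 : ℝ) ≤ x := zero_le_one.trans (le_of_lt hx)
    simp only [hP]
    gcongr
  have hP'm : MonotoneOn P' (Set.Ioi 1) := fun x hx y _ hxy => by
    have : (0 : ℝ) ≤ x := zero_le_one.trans (le_of_lt hx)
    simp only [hP']
    gcongr
  have hPpos (x : ℝ) (hx : x ∈ Set.Ioi (1 : ℝ)) : 0 < P x := by
    have hx0 : (0 : ℝ) < x := zero_lt_one.trans hx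
    refine Finset.sum_pos (fun i _ => ?_) ⟨⟨0, hr⟩, Finset.mem_univ _⟩
    have : (0 : ℝ) < kk i := by exact_mod_cast hkk i
    positivity
  have hP'0 (x : ℝ) (hx : x ∈ Set.Ioi (1 : ℝ)) : 0 ≤ P' x := by
    have hx0 : (0 : ℝ) < x := zero_lt_one.trans hx
    exact Finset.sum_nonneg fun i _ => by positivity
  have hgd : DifferentiableOn ℝ g (Set.Ioi 1) := hsm.differentiableOn (by norm_num)
  have hg'd : DifferentiableOn ℝ (deriv g) (Set.Ioi 1) :=
    (hsm.deriv_of_isOpen isOpen_Ioi (m := 1) (by norm_num)).differentiableOn (by norm_num)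
  have hgm : MonotoneOn g (Set.Ioi 1) :=
    monotoneOn_of_deriv_nonneg (convex_Ioi 1) hgd.continuousOn
      (by rwa [interior_Ioi]) (by rwa [interior_Ioi])
  have hg'm : MonotoneOn (deriv g) (Set.Ioi 1) :=
    monotoneOn_of_deriv_nonneg (convex_Ioi 1) hg'd.continuousOn
      (by rwa [interior_Ioi]) (by rwa [interior_Ioi])
  have hg0 (x : ℝ) (hx : x ∈ Set.Ioi (1 : ℝ)) : 0 ≤ g x := (hpos x hx).le
  have hP0 (x : ℝ) (hx : x ∈ Set.Ioi (1 : ℝ)) : 0 ≤ P x := (hPpos x hx).le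
  have hGm : MonotoneOn (fun t => g t * P t) (Set.Ioi 1) := hgm.mul hPm hg0 hP0
  have key {m n : ℕ} (hm : 1 ≤ m) (hmn : m < n) :=
    deriv_mul_pow_sub_deriv_mul_pow (G := fun t => g t * P t)
      (G' := fun t => deriv g t * P t + g t * P' t)
      (fun x hx => ((hgd.differentiableAt (Ioi_mem_nhds hx)).hasDerivAt.mul (hPd x)))
      (fun x hx => mul_nonneg (hg0 x hx) (hP0 x hx))
      (fun x hx => add_nonneg (mul_nonneg (hd1 x hx) (hP0 x hx))
        (mul_nonneg (hg0 x hx) (hP'0 x hx)))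
      hGm ((hg'm.mul hPm hd1 hP0).add (hgm.mul hP'm hg0 hP'0)) hm hmn
  exact ⟨fun m n hm hmn => (key hm hmn).1.mono hsub,
    g a * P a, mul_pos (hpos a ha) (hPpos a ha), fun m n hm hmn x hx =>
      (hGm ha (hsub hx) hx.1).trans ((key hm hmn).2 x (hsub hx))⟩
end
end

section
/- Let d ≥ 2 and let A be a d×d integer matrix with determinant ±1 all of whose complex eigenvalues equal 1 (equivalently, with characteristic polynomial (X−1)^d). Then there exists a d×d integer matrix P with determinant 1 such that P⁻¹AP is a lower triangular integer matrix (necessarily with all diagonal entries equal to 1). -/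
open Finset

noncomputable section

/-- A nilpotent endomorphism of a nontrivial projective module is killed by some nonzero linear
functional. -/
theorem exists_ne_zero_dual_comp_eq_zero_of_isNilpotent {R M : Type*} [CommRing R]
    [AddCommGroup M] [Module R M] [Module.Projective R M] [Nontrivial M]
    {f : Module.End R M} (hf : IsNilpotent f) :
    ∃ φ : M →ₗ[R] R, φ ≠ 0 ∧ ∀ x, φ (f x) = 0 := by
  have hk : f ^ (nilpotencyClass f - 1) ≠ 0 := pow_pred_nilpotencyClass hf
  have hpos : 0 < nilpotencyClass f := pos_nilpotencyClass_iff.mpr hf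
  obtain ⟨x, hx⟩ : ∃ x, (f ^ (nilpotencyClass f - 1)) x ≠ 0 := by
    by_contra! h
    exact hk (LinearMap.ext h)
  obtain ⟨ψ, hψ⟩ := Module.Projective.exists_dual_ne_zero R hx
  refine ⟨ψ ∘ₗ (f ^ (nilpotencyClass f - 1)), fun h ↦ hψ (LinearMap.congr_fun h x), fun y ↦ ?_⟩
  have : (f ^ (nilpotencyClass f - 1)) (f y) = 0 := by
    rw [← Module.End.mul_apply, ← pow_succ, Nat.sub_add_cancel hpos, pow_nilpotencyClass hf]
    rfl
  simp [this]

section mkFinCons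

variable {R M : Type*} [CommRing R] [AddCommGroup M] [Module R M] {n : ℕ} {N : Submodule R M}
  (y : M) (b : Module.Basis (Fin n) R N) (hli : ∀ (c : R), ∀ x ∈ N, c • y + x = 0 → c = 0)
  (hsp : ∀ z : M, ∃ c : R, z + c • y ∈ N)

theorem mkFinCons_repr_coe_zero (x : N) :
    (Module.Basis.mkFinCons y b hli hsp).repr x 0 = 0 := by
  have : (Module.Basis.mkFinCons y b hli hsp).coord 0 ∘ₗ N.subtype = 0 := b.ext fun k ↦ by
    have hk : (b k : M) = Module.Basis.mkFinCons y b hli hsp k.succ := by simp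
    simp [hk, -Module.Basis.coe_mkFinCons]
  exact LinearMap.congr_fun this x

theorem mkFinCons_repr_coe_succ (x : N) (i : Fin n) :
    (Module.Basis.mkFinCons y b hli hsp).repr x i.succ = b.repr x i := by
  have : (Module.Basis.mkFinCons y b hli hsp).coord i.succ ∘ₗ N.subtype = b.coord i :=
    b.ext fun k ↦ by
      have hk : (b k : M) = Module.Basis.mkFinCons y b hli hsp k.succ := by simp
      simp [hk, Finsupp.single_apply, -Module.Basis.coe_mkFinCons]
  exact LinearMap.congr_fun this x

end mkFinCons

/-- A nilpotent endomorphism of a finite free module over a principal ideal domain is strictly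
lower triangular in a suitable basis. -/
theorem exists_basis_strictly_lower_triangular_of_isNilpotent {R : Type*} [CommRing R]
    [IsDomain R] [IsPrincipalIdealRing R] (n : ℕ) :
    ∀ {M : Type*} [AddCommGroup M] [Module R M] [Module.Free R M] [Module.Finite R M]
      {f : Module.End R M}, Module.finrank R M = n → IsNilpotent f →
      ∃ b : Module.Basis (Fin n) R M, ∀ i j, i ≤ j → b.repr (f (b j)) i = 0 := by
  induction n with
  | zero =>
    intro M _ _ _ _ f hn _
    exact ⟨Module.finBasisOfFinrankEq R M hn, fun i ↦ i.elim0⟩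
  | succ n ih =>
    intro M _ _ _ _ f hn hf
    have : Nontrivial M := Module.nontrivial_of_finrank_pos (R := R) (by omega)
    obtain ⟨φ, hφ, hφf⟩ := exists_ne_zero_dual_comp_eq_zero_of_isNilpotent hf
    obtain ⟨v, hv⟩ : ∃ v, φ v = Submodule.IsPrincipal.generator (LinearMap.range φ) :=
      Submodule.IsPrincipal.generator_mem (LinearMap.range φ)
    have hv0 : φ v ≠ 0 := by
      rwa [hv, Ne, ← Submodule.IsPrincipal.eq_bot_iff_generator_eq_zero, LinearMap.range_eq_bot]
    have hli : ∀ (c : R), ∀ x ∈ LinearMap.ker φ, c • v + x = 0 → c = 0 := by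
      intro c x hx h
      have := congrArg φ h
      rw [map_add, LinearMap.mem_ker.mp hx] at this
      simpa [hv0] using this
    have hsp : ∀ z : M, ∃ c : R, z + c • v ∈ LinearMap.ker φ := by
      intro z
      obtain ⟨c, hc⟩ := (Submodule.IsPrincipal.mem_iff_eq_smul_generator _).mp
        (LinearMap.mem_range_self φ z)
      exact ⟨-c, by simp [hc, hv]⟩
    have hker : Module.finrank R (LinearMap.ker φ) = n := by
      have := Module.finrank_eq_card_basis
        (Module.Basis.mkFinCons v (Module.finBasis R (LinearMap.ker φ)) hli hsp)
      simp only [Fintype.card_fin] at this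
      omega
    have hmaps : ∀ x ∈ LinearMap.ker φ, f x ∈ LinearMap.ker φ := fun x _ ↦ hφf x
    obtain ⟨b, hb⟩ := ih (f := f.restrict hmaps) hker (Module.End.isNilpotent.restrict hmaps hf)
    refine ⟨Module.Basis.mkFinCons v b hli hsp, fun i j hij ↦ ?_⟩
    cases i using Fin.cases with
    | zero => exact mkFinCons_repr_coe_zero v b hli hsp ⟨_, hφf _⟩
    | succ i =>
      cases j using Fin.cases with
      | zero => exact absurd hij (by simp)
      | succ j =>
        have hj : f (Module.Basis.mkFinCons v b hli hsp j.succ) =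
            (f.restrict hmaps (b j) : LinearMap.ker φ) := by simp
        rw [hj, mkFinCons_repr_coe_succ]
        exact hb i j (Fin.succ_le_succ_iff.mp hij)

theorem isNilpotent_sub_one_of_charpoly_map_eq {d : ℕ} {A : Matrix (Fin d) (Fin d) ℤ}
    (h : (A.map ((↑) : ℤ → ℂ)).charpoly = (Polynomial.X - 1) ^ d) : IsNilpotent (A - 1) := by
  have hA : A.charpoly = (Polynomial.X - 1) ^ d := by
    apply Polynomial.map_injective (Int.castRingHom ℂ) Int.cast_injective
    rw [← Matrix.charpoly_map]
    simpa using h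
  refine ⟨d, ?_⟩
  simpa [hA] using A.aeval_self_charpoly

/-- Rescaling one vector of a basis by a unit makes its determinant `1`. -/
theorem exists_unitsSMul_det_eq_one {R M ι : Type*} [CommRing R] [AddCommGroup M] [Module R M]
    [Fintype ι] [DecidableEq ι] [Nonempty ι] (e b : Module.Basis ι R M) :
    ∃ w : ι → Rˣ, e.det (b.unitsSMul w) = 1 := by
  obtain ⟨u, hu⟩ := e.isUnit_det b
  refine ⟨Pi.mulSingle (Classical.arbitrary ι) u⁻¹, ?_⟩
  rw [← e.det_mul_det b, ← hu, Module.Basis.det_unitsSMul_self, ← Units.coe_prod,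
    Fintype.prod_eq_single (Classical.arbitrary ι) fun i hi ↦ Pi.mulSingle_eq_of_ne hi _,
    Pi.mulSingle_eq_same, Units.mul_inv]

/-- If `A` is a `d × d` integer matrix with determinant `±1` all of
whose complex eigenvalues equal `1` (i.e. its characteristic polynomial over `ℂ` is
`(X - 1)^d`), then there is an integer matrix `P` with `det P = 1` such that `P⁻¹ A P` is
lower triangular with all diagonal entries equal to `1`. -/
theorem exists_integral_conjugation_lower_triangular
    (d : ℕ) (hd : 2 ≤ d) (A : Matrix (Fin d) (Fin d) ℤ)
    (hdet : A.det = 1 ∨ A.det = -1)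
    (heig : (A.map ((↑) : ℤ → ℂ)).charpoly = (Polynomial.X - 1) ^ d) :
    ∃ P : Matrix (Fin d) (Fin d) ℤ, P.det = 1 ∧
      (∀ i j : Fin d, i < j → (P⁻¹ * A * P) i j = 0) ∧
      (∀ i : Fin d, (P⁻¹ * A * P) i i = 1) := by
  have : Nonempty (Fin d) := ⟨⟨0, by omega⟩⟩
  have hN : IsNilpotent (Matrix.toLin' (A - 1)) :=
    (isNilpotent_sub_one_of_charpoly_map_eq heig).map Matrix.toLinAlgEquiv'
  obtain ⟨b, hb⟩ := exists_basis_strictly_lower_triangular_of_isNilpotent d (by simp) hN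
  let e := Pi.basisFun ℤ (Fin d)
  obtain ⟨w, hw⟩ := exists_unitsSMul_det_eq_one e b
  set c := b.unitsSMul w with hc
  have hleft : c.toMatrix e * e.toMatrix c = 1 := c.toMatrix_mul_toMatrix_flip e
  have hN_std : LinearMap.toMatrix e e (Matrix.toLin' (A - 1)) = A - 1 :=
    LinearMap.toMatrix'_toLin' _
  have hconj : (e.toMatrix c)⁻¹ * A * e.toMatrix c =
      1 + LinearMap.toMatrix c c (Matrix.toLin' (A - 1)) := by
    rw [← basis_toMatrix_mul_linearMap_toMatrix_mul_basis_toMatrix c e c e, hN_std,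
      Matrix.inv_eq_left_inv hleft, mul_sub, sub_mul, mul_one, hleft, add_sub_cancel]
  have htri (i j : Fin d) (hij : i ≤ j) :
      LinearMap.toMatrix c c (Matrix.toLin' (A - 1)) i j = 0 := by
    rw [LinearMap.toMatrix_apply, hc, Module.Basis.repr_unitsSMul, Module.Basis.unitsSMul_apply,
      Units.smul_def (w j), map_smul, map_smul, Finsupp.smul_apply, hb i j hij, smul_zero,
      smul_zero]
  refine ⟨e.toMatrix c, hw, fun i j hij ↦ ?_, fun i ↦ ?_⟩
  · rw [hconj, Matrix.add_apply, htri i j hij.le, Matrix.one_apply_ne hij.ne, add_zero]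
  · rw [hconj, Matrix.add_apply, htri i i le_rfl, Matrix.one_apply_eq, add_zero]
end
end
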